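/- arXiv:2310.04549 — 2 statements merged into one kernel-verified Lean document; each statement's English description precedes it below -/
import Mathlib

section
/- Under Assumption P, for any n ≥ 1 and any two adjacent arcs a, a' ∈ I_n (i.e. arcs sharing an endpoint) one has μ(a') ≤ c_μ·(8MS/θ)^s·μ(a). -/
open Metric MeasureTheory Filter Set Topology
open scoped ENNReal NNReal

noncomputable section

abbrev E2 := EuclideanSpace ℝ (Fin 2)

/-- The interior of `b` in the relative topology of `Γ`, viewed back in the plane. -/
def relInt (Γ b : Set E2) : Set E2 :=
  Subtype.val '' (interior ((Subtype.val ⁻¹' b) : Set ↥Γ))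

/-- A proper closed connected subset of a topological circle is open away from two of its points. -/
theorem exists_isOpen_diff_pair_of_homeomorph_sphere {X : Type*} [TopologicalSpace X]
    (h : X ≃ₜ ↥(sphere (0 : E2) 1)) {A : Set X} (hA : IsClosed A) (hconn : IsConnected A)
    (hne : A ≠ univ) : ∃ x ∈ A, ∃ y ∈ A, IsOpen (A \ {x, y}) := by
  obtain ⟨z, hz⟩ := (ne_univ_iff_exists_notMem A).1 hne
  have : Fact (Module.finrank ℝ E2 = 1 + 1) := ⟨by simp⟩
  have : CompactSpace X := h.symm.compactSpace
  let σ := stereographic' 1 (h z)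
  let g : X → ℝ := fun x => σ (h x) 0
  have hsrc : ∀ x, x ≠ z → h x ∈ σ.source := fun x hx => by
    simpa [σ] using h.injective.ne hx
  have hopen : IsOpen ({z}ᶜ : Set X) := by
    have : IsOpen (h ⁻¹' {h z}ᶜ) := isOpen_compl_singleton.preimage h.continuous
    convert this using 1
    ext x
    simp
  have hg : ContinuousOn g {z}ᶜ := by
    have : ContinuousOn (fun x => σ (h x)) {z}ᶜ :=
      σ.continuousOn.comp h.continuous.continuousOn hsrc
    exact (PiLp.continuous_apply 2 (fun _ : Fin 1 => ℝ) 0).comp_continuousOn this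
  have hinj : InjOn g {z}ᶜ := by
    intro x hx y hy hxy
    apply h.injective
    apply σ.injOn (hsrc x hx) (hsrc y hy)
    ext i
    fin_cases i
    exact hxy
  have hAz : A ⊆ {z}ᶜ := fun x hx hxz => hz (hxz ▸ hx)
  have himage := eq_Icc_of_connected_compact (hconn.image g (hg.mono hAz))
    (hA.isCompact.image_of_continuousOn (hg.mono hAz))
  set c := sInf (g '' A)
  set e := sSup (g '' A)
  have hce : c ≤ e := by
    obtain ⟨x, hx⟩ := hconn.nonempty
    have : g x ∈ Icc c e := himage ▸ mem_image_of_mem g hx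
    exact this.1.trans this.2
  obtain ⟨x, hx, hxc⟩ : c ∈ g '' A := himage ▸ left_mem_Icc.2 hce
  obtain ⟨y, hy, hye⟩ : e ∈ g '' A := himage ▸ right_mem_Icc.2 hce
  refine ⟨x, hx, y, hy, ?_⟩
  convert hg.isOpen_inter_preimage hopen (isOpen_Ioo (a := c) (b := e)) using 1
  ext w
  constructor
  · rintro ⟨hw, hwxy⟩
    have hwI : g w ∈ Icc c e := himage ▸ mem_image_of_mem g hw
    refine ⟨hAz hw, lt_of_le_of_ne hwI.1 fun hcw => hwxy (Or.inl ?_),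
      lt_of_le_of_ne hwI.2 fun hwe => hwxy (Or.inr ?_)⟩
    · exact hinj (hAz hw) (hAz hx) (hcw.symm.trans hxc.symm)
    · exact hinj (hAz hw) (hAz hy) (hwe.trans hye.symm)
  · rintro ⟨hwz, hcw, hwe⟩
    obtain ⟨v, hv, hvw⟩ : g w ∈ g '' A := himage ▸ ⟨hcw.le, hwe.le⟩
    obtain rfl : v = w := hinj (hAz hv) hwz hvw
    refine ⟨hv, ?_⟩
    rintro (rfl | rfl)
    · exact hcw.ne hxc.symm
    · exact hwe.ne hye

/-- A connected subset of a Jordan curve meeting a proper subarc but avoiding its endpoints lies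
in that subarc. -/
theorem exists_endpoints_of_jordan_subarc {Γ b : Set E2}
    (h : ↥Γ ≃ₜ ↥(sphere (0 : E2) 1)) (hbΓ : b ⊆ Γ) (hb : IsClosed b) (hconn : IsConnected b)
    (hne : b ≠ Γ) : ∃ x ∈ b, ∃ y ∈ b, ∀ C : Set E2, C ⊆ Γ → IsPreconnected C →
      (C ∩ b).Nonempty → x ∉ C → y ∉ C → C ⊆ b := by
  have hval : ∀ t ⊆ Γ, (Subtype.val '' (Subtype.val ⁻¹' t : Set Γ)) = t := fun t ht => by
    rw [Subtype.image_preimage_coe, inter_eq_right.2 ht]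
  have hpre : ∀ t ⊆ Γ, IsPreconnected t → IsPreconnected (Subtype.val ⁻¹' t : Set Γ) :=
    fun t ht htc => by
      rw [← IsInducing.subtypeVal.isPreconnected_image, hval t ht]
      exact htc
  set A : Set Γ := Subtype.val ⁻¹' b
  have hA : IsClosed A := hb.preimage continuous_subtype_val
  have hAconn : IsConnected A := by
    obtain ⟨w, hw⟩ := hconn.nonempty
    exact ⟨⟨⟨w, hbΓ hw⟩, hw⟩, hpre b hbΓ hconn.isPreconnected⟩
  have hAne : A ≠ univ := fun hA => hne <| hbΓ.antisymm fun w hw => by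
    have : (⟨w, hw⟩ : Γ) ∈ A := hA ▸ mem_univ _
    exact this
  obtain ⟨x, hx, y, hy, hopen⟩ :=
    exists_isOpen_diff_pair_of_homeomorph_sphere h hA hAconn hAne
  refine ⟨x, hx, y, hy, fun C hC hCc ⟨w, hwC, hwb⟩ hxC hyC => ?_⟩
  have hnot : ∀ u : Γ, (u : E2) ∈ C → u ∉ ({x, y} : Set Γ) := by
    rintro u hu (rfl | rfl)
    exacts [hxC hu, hyC hu]
  have hsub := (hpre C hC hCc).subset_left_of_subset_union hopen hA.isOpen_compl
    (disjoint_compl_right.mono_left sdiff_subset)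
    (fun u hu => by
      by_cases huA : u ∈ A
      exacts [Or.inl ⟨huA, hnot u hu⟩, Or.inr huA])
    ⟨⟨w, hC hwC⟩, hwC, hwb, hnot _ hwC⟩
  exact fun v hv => (hsub (show (⟨v, hC hv⟩ : Γ) ∈ Subtype.val ⁻¹' C from hv)).1

/-- A connected set of diameter larger than `4 * u` has uncountably many points at distance more
than `u` from two given points of it. -/
theorem not_countable_far_from_pair {X : Type*} [PseudoMetricSpace X] {b : Set X}
    (hconn : IsPreconnected b) {x y : X} (hx : x ∈ b) (hy : y ∈ b) {u : ℝ} (hu0 : 0 ≤ u)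
    (hu : 4 * u < diam b) : ¬ {ξ ∈ b | u < dist ξ x ∧ u < dist ξ y}.Countable := by
  obtain ⟨v, huv, hvb⟩ : ∃ v, u < v ∧ v < diam b / 4 := exists_between (by linarith)
  obtain ⟨w, hwb, hwx, hwy⟩ : ∃ w ∈ b, v ≤ dist w x ∧ v ≤ dist w y := by
    by_contra! hcon
    have hcov : b ⊆ ball x v ∪ ball y v := fun w hw =>
      (lt_or_ge (dist w x) v).imp id fun hwx => hcon w hw hwx
    obtain ⟨z, -, hzx, hzy⟩ := hconn _ _ isOpen_ball isOpen_ball hcov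
      ⟨x, hx, mem_ball_self (hu0.trans_lt huv)⟩ ⟨y, hy, mem_ball_self (hu0.trans_lt huv)⟩
    rw [mem_ball] at hzx hzy
    have hxy : dist x y ≤ 2 * v := by linarith [dist_triangle_left x y z]
    have hdiam : diam b ≤ 4 * v := by
      refine diam_le_of_forall_dist_le (by linarith) fun p hp q hq => ?_
      rcases hcov hp with hp | hp <;> rcases hcov hq with hq | hq <;> rw [mem_ball] at hp hq
      · linarith [dist_triangle_right p q x]
      · linarith [dist_triangle p x q, dist_triangle x y q, dist_comm q y]
      · linarith [dist_triangle p y q, dist_triangle y x q, dist_comm q x, dist_comm x y]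
      · linarith [dist_triangle_right p q y]
    linarith
  intro hcount
  let f : X → ℝ := fun ξ => min (dist ξ x) (dist ξ y)
  have hf : Continuous f := by fun_prop
  have hIoo : Ioo u v ⊆ f '' {ξ ∈ b | u < dist ξ x ∧ u < dist ξ y} := by
    intro t ht
    have hfx : f x ≤ t := by simpa [f] using hu0.trans ht.1.le
    obtain ⟨ξ, hξ, rfl⟩ := hconn.intermediate_value hx hwb hf.continuousOn
      ⟨hfx, ht.2.le.trans (le_min hwx hwy)⟩
    exact ⟨ξ, ⟨hξ, lt_min_iff.1 ht.1⟩, rfl⟩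
  exact huv.not_ge (Cardinal.Real.Ioo_countable_iff.1 ((hcount.image f).mono hIoo))

/-- Only countably many circles of a given radius are charged by a nonatomic finite measure. -/
theorem countable_setOf_measure_sphere_pos (μ : Measure E2) [IsFiniteMeasure μ] [NullSingletonClass μ]
    (R : ℝ) : {ξ : E2 | 0 < μ (sphere ξ R)}.Countable := by
  refine Measure.countable_meas_pos_of_disjoint_iUnion₀
    (fun ξ => isClosed_sphere.measurableSet.nullMeasurableSet) fun ξ η hξη => ?_
  change μ (sphere ξ R ∩ sphere η R) = 0
  refine Set.Countable.measure_zero ?_ μ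
  by_cases hsub : (sphere ξ R ∩ sphere η R).Subsingleton
  · exact hsub.countable
  · rw [not_subsingleton_iff] at hsub
    obtain ⟨p, hp, q, hq, hpq⟩ := hsub
    refine ((countable_singleton q).insert p).mono fun w hw => ?_
    exact EuclideanGeometry.eq_of_dist_eq_of_dist_eq_of_finrank_eq_two (by simp) hξη hpq
      hp.1 hq.1 hw.1 hp.2 hq.2 hw.2

/-- A probability measure whose balls grow at least linearly in the radius is nonatomic. -/
theorem nullSingletonClass_of_growth {X : Type*} [PseudoMetricSpace X] [MeasurableSpace X]
    (μ : Measure X) [IsProbabilityMeasure μ] {Γ : Set X} (hΓ : μ Γᶜ = 0) {c d D : ℝ}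
    (hc : 0 < c) (hd : 1 ≤ d) (hD : 0 < D)
    (hgrowth : ∀ x ∈ Γ, ∀ r > 0, ∀ t > 1, t * r ≤ D →
      c⁻¹ * t ^ d * (μ (ball x r)).toReal ≤ (μ (ball x (t * r))).toReal) : NullSingletonClass μ := by
  refine ⟨fun x => ?_⟩
  by_cases hx : x ∈ Γ
  swap
  · exact measure_mono_null (singleton_subset_iff.2 hx) hΓ
  by_contra hpos
  have hm : 0 < μ.real {x} := ENNReal.toReal_pos hpos (measure_ne_top μ _)
  set t : ℝ := c / μ.real {x} + 1 with ht
  have ht1 : 1 < t := by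
    have := div_pos hc hm
    linarith
  have ht0 : 0 < t := by linarith
  have h1 := hgrowth x hx (D / t) (by positivity) t ht1 (by field_simp; rfl)
  have h2 : μ.real {x} ≤ μ.real (ball x (D / t)) :=
    measureReal_mono (singleton_subset_iff.2 (mem_ball_self (by positivity)))
  have h3 : μ.real (ball x (t * (D / t))) ≤ 1 := measureReal_le_one
  have h4 : t ≤ t ^ d := by simpa using Real.rpow_le_rpow_of_exponent_le ht1.le hd
  have h5 : c⁻¹ * t * μ.real {x} ≤ 1 :=
    calc c⁻¹ * t * μ.real {x} ≤ c⁻¹ * t ^ d * μ.real (ball x (D / t)) := by gcongr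
      _ ≤ 1 := h1.trans h3
  have h6 : c⁻¹ * t * μ.real {x} = 1 + c⁻¹ * μ.real {x} := by
    rw [ht]
    field_simp
  have : 0 < c⁻¹ * μ.real {x} := by positivity
  linarith

theorem stmt_3
    (Γ : Set E2) (hΓcomp : IsCompact Γ)
    (hΓJ : Nonempty (↥Γ ≃ₜ ↥(sphere (0:E2) 1)))
    (S : ℝ) (hS1 : 1 ≤ S)
    (hbt : ∀ x ∈ Γ, ∀ y ∈ Γ, x ≠ y → ∃ b : Set E2, b ⊆ Γ ∧ IsClosed b ∧ IsConnected b ∧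
      x ∈ b ∧ y ∈ b ∧ diam b ≤ S * dist x y)
    (p q M : ℝ) (hp0 : 0 < p) (hp1 : p < 1) (hq0 : 0 < q) (hq1 : q < 1) (hM : 1 < M)
    (ω : ℕ → ℝ) (hω : ∀ i, ω i = p ∨ ω i = q)
    (k : ℕ → ℕ) (hk : ∀ n, 0 < k n)
    (a : (n : ℕ) → Fin (k n) → Set E2)
    (pe qe : (n : ℕ) → Fin (k n) → E2)
    (harc : ∀ n j, a n j ⊆ Γ ∧ IsClosed (a n j) ∧ IsConnected (a n j) ∧
      pe n j ∈ a n j ∧ qe n j ∈ a n j)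
    (hcover : ∀ n, (⋃ j, a n j) = Γ)
    (hdisj : ∀ n, Pairwise fun j j' => Disjoint (relInt Γ (a n j)) (relInt Γ (a n j')))
    (hdiam : ∀ n j, (∏ i ∈ Finset.range n, ω i) * diam Γ ≤ diam (a n j) ∧
      diam (a n j) < M * ((∏ i ∈ Finset.range n, ω i) * diam Γ))
    (d s cμ : ℝ) (hd1 : 1 ≤ d) (hds : d ≤ s) (hs2 : s < 2) (hcμ : 1 < cμ)
    (μ : Measure E2) [IsProbabilityMeasure μ]
    (hsupp : (∀ x ∈ Γ, ∀ r > 0, 0 < μ (ball x r)) ∧ μ Γᶜ = 0)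
    (hdbl : ∀ x ∈ Γ, ∀ r > 0, ∀ t > 1, t * r ≤ diam Γ →
      cμ⁻¹ * t ^ d * (μ (ball x r)).toReal ≤ (μ (ball x (t * r))).toReal ∧
      (μ (ball x (t * r))).toReal ≤ cμ * t ^ s * (μ (ball x r)).toReal)
    (θ : ℝ) (hθ0 : 0 < θ) (hθ1 : θ ≤ 1)
    (hθ : ∀ ξ ∈ Γ, ∀ r > 0, Γ ∩ ball ξ (θ * r) ⊆ connectedComponentIn (Γ ∩ closedBall ξ r) ξ)
    :
    ∀ n : ℕ, 1 ≤ n → ∀ j j' : Fin (k n), j ≠ j' →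
      (pe n j = pe n j' ∨ pe n j = qe n j' ∨ qe n j = pe n j' ∨ qe n j = qe n j') →
      (μ (a n j')).toReal ≤ cμ * (8 * M * S / θ) ^ s * (μ (a n j)).toReal := by
  intro n _ j j' _ hadj
  obtain ⟨hbΓ, hbcl, hbconn, hpb, hqb⟩ := harc n j
  obtain ⟨hbΓ', -, -, hpb', hqb'⟩ := harc n j'
  obtain ⟨z, hz, hz'⟩ : (a n j ∩ a n j').Nonempty := by
    rcases hadj with h | h | h | h
    exacts [⟨_, hpb, h ▸ hpb'⟩, ⟨_, hpb, h ▸ hqb'⟩, ⟨_, hqb, h ▸ hpb'⟩, ⟨_, hqb, h ▸ hqb'⟩]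
  obtain ⟨hρb, hbM⟩ := hdiam n j
  have hbM' := (hdiam n j').2
  set ρ := (∏ i ∈ Finset.range n, ω i) * diam Γ
  generalize a n j = b at *
  generalize a n j' = b' at *
  have hM0 : 0 < M := by linarith
  have hρ : 0 < ρ := pos_of_mul_pos_right (diam_nonneg.trans_lt hbM) hM0.le
  have hs0 : 0 ≤ s := by linarith
  have hbddΓ := hΓcomp.isBounded
  have hbD : diam b ≤ diam Γ := diam_mono hbΓ hbddΓ
  have ht1 : 1 < 8 * M / θ := by
    rw [lt_div_iff₀ hθ0]
    linarith
  have hconst : (8 * M / θ) ^ s ≤ (8 * M * S / θ) ^ s := by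
    have : 8 * M ≤ 8 * M * S := le_mul_of_one_le_right (by positivity) hS1
    gcongr ?_ ^ s
    gcongr
  by_cases hbne : b = Γ
  · have h1 : 1 ≤ (8 * M / θ) ^ s := Real.one_le_rpow ht1.le hs0
    have h2 : μ.real b' ≤ μ.real b := measureReal_mono (hbne ▸ hbΓ')
    have h3 : 1 ≤ cμ * (8 * M * S / θ) ^ s := by nlinarith
    calc (μ b').toReal ≤ μ.real b := h2
      _ ≤ cμ * (8 * M * S / θ) ^ s * μ.real b := le_mul_of_one_le_left measureReal_nonneg h3
  have : NullSingletonClass μ := nullSingletonClass_of_growth μ hsupp.2 (by linarith) hd1 (by linarith : 0 < diam Γ)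
    fun x hx r hr t ht htr => (hdbl x hx r hr t ht htr).1
  obtain ⟨x, hx, y, hy, hends⟩ :=
    exists_endpoints_of_jordan_subarc hΓJ.some hbΓ hbcl hbconn hbne
  -- The second arc lies in the closed ball of radius `R` about any point of `b`.
  set R := min (diam b + diam b') (diam Γ)
  have hR0 : 0 < R := lt_min (by linarith [diam_nonneg (s := b')]) (by linarith)
  have hRM : R < 2 * M * ρ := (min_le_left _ _).trans_lt (by linarith)
  set u := R / (8 * M)
  have hu0 : 0 < u := by positivity
  have hu : 4 * u < diam b := by
    refine lt_of_lt_of_le ?_ hρb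
    rw [← lt_div_iff₀' (by norm_num), div_lt_iff₀ (by positivity)]
    linarith
  obtain ⟨ξ, ⟨hξ, hξx, hξy⟩, hξR⟩ : ∃ ξ ∈ {ξ ∈ b | u < dist ξ x ∧ u < dist ξ y},
      ¬ 0 < μ (sphere ξ R) := by
    by_contra! hcon
    exact not_countable_far_from_pair hbconn.isPreconnected hx hy hu0.le hu
      ((countable_setOf_measure_sphere_pos μ R).mono hcon)
  have hinner : Γ ∩ ball ξ (θ * u) ⊆ b := by
    have hCsub := connectedComponentIn_subset (Γ ∩ closedBall ξ u) ξ
    refine (hθ ξ (hbΓ hξ) u hu0).trans (hends _ (hCsub.trans inter_subset_left)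
      isPreconnected_connectedComponentIn
      ⟨ξ, mem_connectedComponentIn ⟨hbΓ hξ, mem_closedBall_self hu0.le⟩, hξ⟩ ?_ ?_)
    · exact fun h => hξx.not_ge (dist_comm x ξ ▸ mem_closedBall.1 (hCsub h).2)
    · exact fun h => hξy.not_ge (dist_comm y ξ ▸ mem_closedBall.1 (hCsub h).2)
  have houter : b' ⊆ ball ξ R ∪ sphere ξ R := by
    rw [ball_union_sphere]
    intro w hw
    refine le_min ?_ (dist_le_diam_of_mem hbddΓ (hbΓ' hw) (hbΓ hξ))
    have h1 := dist_le_diam_of_mem (hbddΓ.subset hbΓ) hz hξ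
    have h2 := dist_le_diam_of_mem (hbddΓ.subset hbΓ') hw hz'
    linarith [dist_triangle w z ξ]
  have hμb' : μ b' ≤ μ (ball ξ R) := by
    calc μ b' ≤ μ (ball ξ R ∪ sphere ξ R) := measure_mono houter
      _ ≤ μ (ball ξ R) + μ (sphere ξ R) := measure_union_le _ _
      _ = μ (ball ξ R) := by rw [nonpos_iff_eq_zero.1 (not_lt.1 hξR), add_zero]
  have hμb : μ (ball ξ (θ * u)) ≤ μ b := by
    calc μ (ball ξ (θ * u)) ≤ μ (b ∪ Γᶜ) := measure_mono fun w hw => by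
          by_cases hwΓ : w ∈ Γ
          exacts [Or.inl (hinner ⟨hwΓ, hw⟩), Or.inr hwΓ]
      _ ≤ μ b + μ Γᶜ := measure_union_le _ _
      _ = μ b := by rw [hsupp.2, add_zero]
  have htr : 8 * M / θ * (θ * u) = R := by
    simp only [u]
    field_simp
  have hdouble := (hdbl ξ (hbΓ hξ) (θ * u) (by positivity) (8 * M / θ) ht1
    (htr.trans_le (min_le_right _ _))).2
  rw [htr] at hdouble
  calc (μ b').toReal ≤ (μ (ball ξ R)).toReal := ENNReal.toReal_mono (measure_ne_top μ _) hμb'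
    _ ≤ cμ * (8 * M / θ) ^ s * (μ (ball ξ (θ * u))).toReal := hdouble
    _ ≤ cμ * (8 * M * S / θ) ^ s * (μ b).toReal := by
      gcongr
      exact measure_ne_top μ _
end
end

section
/- Under Assumptions P and B, for 1/2 < α < 1+(2−s)/2, A ≥ max{128S, M}, and any bounded Lipschitz function u: ℝ² → ℝ, the short-range part of the approximating boundary form vanishes in the limit: lim_{n→∞} Q^{α,s}_n(u) = 0, where Q^{α,s}_n(u) := ∫_{Γ_n}∫_{Γ_n} 1_{|ξ−η| ≤ A·r_n} (u(ξ)−u(η))² / (|ξ−η|^{2α−1}·μ_n(B(ξ,|ξ−η|))) μ_n(dξ)μ_n(dη). -/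
open Metric MeasureTheory Filter Set Topology
open scoped ENNReal NNReal

noncomputable section

/-- A closed connected subset of the circle has at most two boundary points. -/
theorem exists_frontier_subset_pair_sphere {C : Set (sphere (0 : E2) 1)} (hC : IsClosed C)
    (hconn : IsConnected C) : ∃ p q, frontier C ⊆ {p, q} := by
  by_cases h : C = univ
  · obtain ⟨x, -⟩ := hconn.nonempty
    exact ⟨x, x, by simp [h]⟩
  obtain ⟨v, hv⟩ := (ne_univ_iff_exists_notMem C).1 h
  have : Fact (Module.finrank ℝ E2 = 1 + 1) := ⟨by simp⟩
  let φ := stereographic' 1 v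
  let ψ : EuclideanSpace ℝ (Fin 1) ≃ₜ ℝ :=
    (EuclideanSpace.equiv (Fin 1) ℝ).toHomeomorph.trans (Homeomorph.funUnique (Fin 1) ℝ)
  let e := φ.transHomeomorph ψ
  have hsource : e.source = {v}ᶜ := by simp [e, φ]
  have htarget : e.target = univ := by simp [e, φ]
  have hCs : C ⊆ e.source := by
    rw [hsource]; rintro x hx rfl; exact hv hx
  have hcont : ContinuousOn e C := e.continuousOn.mono hCs
  have himg : e '' C = Icc (sInf (e '' C)) (sSup (e '' C)) :=
    eq_Icc_of_connected_compact (hconn.image _ hcont) (hC.isCompact.image_of_continuousOn hcont)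
  set l := sInf (e '' C)
  set r := sSup (e '' C)
  have hopen : IsOpen (e.symm '' Ioo l r) := 
    e.symm.isOpen_image_of_subset_source isOpen_Ioo (by simp [htarget])
  have hsub : e.symm '' Ioo l r ⊆ C := by
    rintro _ ⟨t, ht, rfl⟩
    have : t ∈ e '' C := himg ▸ Ioo_subset_Icc_self ht
    obtain ⟨x, hx, rfl⟩ := this
    rwa [e.left_inv (hCs hx)]
  refine ⟨e.symm l, e.symm r, fun x hx => ?_⟩
  have hxC : x ∈ C := hC.frontier_subset hx
  have hxI : e x ∈ Icc l r := himg ▸ mem_image_of_mem e hxC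
  rcases eq_endpoints_or_mem_Ioo_of_mem_Icc hxI with h | h | h
  · left; rw [← h, e.left_inv (hCs hxC)]
  · right; rw [mem_singleton_iff, ← h, e.left_inv (hCs hxC)]
  · exact absurd (interior_maximal hsub hopen ⟨e x, h, e.left_inv (hCs hxC)⟩) hx.2

/-- Packing bound: at most `N` points at mutual distance `≥ δ * R` fit into a disc of radius `L * R`,
with `N` independent of the scale `R`. -/
theorem exists_card_le_of_separated (L : ℝ) {δ : ℝ} (hδ : 0 < δ) :
    ∃ N : ℕ, ∀ (ι : Type) (x : ι → E2) (s : Finset ι) (c : E2) (R : ℝ), 0 < R →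
      (∀ i ∈ s, dist (x i) c ≤ L * R) →
      (∀ i ∈ s, ∀ j ∈ s, i ≠ j → δ * R ≤ dist (x i) (x j)) → s.card ≤ N := by
  obtain ⟨t, -, ht, hcov⟩ := finite_cover_balls_of_compact
    (isCompact_closedBall (0 : E2) L) (half_pos hδ)
  refine ⟨ht.toFinset.card, fun ι x s c R hR hL hsep => ?_⟩
  have key : ∀ i ∈ s, ∃ y ∈ ht.toFinset, dist (R⁻¹ • (x i - c)) y < δ / 2 := by
    intro i hi
    have : R⁻¹ • (x i - c) ∈ closedBall (0 : E2) L := by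
      rw [mem_closedBall_zero_iff, norm_smul, ← dist_eq_norm, norm_inv, Real.norm_of_nonneg hR.le,
        inv_mul_le_iff₀ hR, mul_comm]
      exact hL i hi
    simpa using hcov this
  choose! f hf hfd using key
  refine Finset.card_le_card_of_injOn f hf fun i hi j hj hij => ?_
  by_contra hne
  have h1 := hfd i hi
  have h2 := hfd j hj
  rw [← hij] at h2
  have h3 := dist_triangle_right (R⁻¹ • (x i - c)) (R⁻¹ • (x j - c)) (f i)
  rw [dist_smul₀, dist_sub_right, norm_inv, Real.norm_of_nonneg hR.le] at h3
  have h4 : R⁻¹ * dist (x i) (x j) < δ := by linarith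
  rw [inv_mul_lt_iff₀ hR, mul_comm] at h4
  exact (hsep i hi j hj hne).not_gt h4

theorem exists_mem_far_from_pair {X : Type*} [MetricSpace X] {b : Set X} (hb : IsPreconnected b)
    {R : ℝ} (hR : 0 < R) (hdiam : R ≤ diam b) (p q : X) :
    ∃ x ∈ b, R / 5 ≤ dist x p ∧ R / 5 ≤ dist x q := by
  obtain ⟨y, hy, z, hz, hyz⟩ : ∃ y ∈ b, ∃ z ∈ b, 4 * R / 5 < dist y z := by
    by_contra! h
    have := diam_le_of_forall_dist_le (by positivity) h
    linarith
  obtain ⟨w, hw, hyw⟩ : ∃ w ∈ b, dist y w = 2 * R / 5 := by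
    refine hb.intermediate_value hy hz (f := fun w => dist y w) (by fun_prop) ⟨?_, ?_⟩
    · simp; positivity
    · linarith
  by_contra! h
  have hyp := h y hy
  have hzp := h z hz
  have hwp := h w hw
  have t1 := dist_triangle y w z
  have t2 := dist_triangle_right y z p
  have t3 := dist_triangle_right y z q
  have t4 := dist_triangle_right y w p
  have t5 := dist_triangle_right y w q
  have t6 := dist_triangle_right w z p
  have t7 := dist_triangle_right w z q
  by_cases h1 : R / 5 ≤ dist y p <;> by_cases h2 : R / 5 ≤ dist z p <;>
    by_cases h3 : R / 5 ≤ dist w p <;> grind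

theorem exists_relFrontier_subset_pair {Γ b : Set E2} (φ : ↥Γ ≃ₜ ↥(sphere (0 : E2) 1))
    (hbΓ : b ⊆ Γ) (hb : IsClosed b) (hconn : IsConnected b) :
    ∃ p q : Γ, frontier (Subtype.val ⁻¹' b : Set Γ) ⊆ {p, q} := by
  have hconn' : IsConnected (Subtype.val ⁻¹' b : Set Γ) := by
    refine ⟨hconn.nonempty.preimage' (by simpa using hbΓ), ?_⟩
    rw [IsInducing.subtypeVal.isPreconnected_image.symm, Subtype.image_preimage_coe,
      inter_eq_self_of_subset_right hbΓ]
    exact hconn.isPreconnected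
  obtain ⟨p, q, hpq⟩ := exists_frontier_subset_pair_sphere
    (φ.isClosedMap _ (hb.preimage continuous_subtype_val)) (hconn'.image φ φ.continuous.continuousOn)
  refine ⟨φ.symm p, φ.symm q, fun x hx => ?_⟩
  have := hpq (φ.image_frontier _ ▸ mem_image_of_mem φ hx)
  rw [mem_insert_iff, mem_singleton_iff] at this ⊢
  exact this.imp (by rintro rfl; simp) (by rintro rfl; simp)

/-- In a curve of bounded turning, an arc of diameter at least `R` contains a relative disc of radius
comparable to `R`. -/
theorem exists_relInt_ball {Γ b : Set E2} (φ : ↥Γ ≃ₜ ↥(sphere (0 : E2) 1))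
    (hbΓ : b ⊆ Γ) (hb : IsClosed b) (hconn : IsConnected b) {S : ℝ} (hS1 : 1 ≤ S)
    (hbt : ∀ x ∈ Γ, ∀ y ∈ Γ, x ≠ y → ∃ c : Set E2, c ⊆ Γ ∧ IsClosed c ∧ IsConnected c ∧
      x ∈ c ∧ y ∈ c ∧ diam c ≤ S * dist x y) (hΓ : Bornology.IsBounded Γ)
    {R : ℝ} (hR : 0 < R) (hdiam : R ≤ diam b) :
    ∃ x ∈ b, ∀ y ∈ Γ, dist x y < (5 * S)⁻¹ * R → y ∈ relInt Γ b := by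
  obtain ⟨p, q, hpq⟩ := exists_relFrontier_subset_pair φ hbΓ hb hconn
  obtain ⟨x, hx, hxp, hxq⟩ :=
    exists_mem_far_from_pair hconn.isPreconnected hR hdiam (p : E2) (q : E2)
  have hclosed : IsClosed (Subtype.val ⁻¹' b : Set Γ) := hb.preimage continuous_subtype_val
  have hxint : (⟨x, hbΓ hx⟩ : Γ) ∈ interior (Subtype.val ⁻¹' b : Set Γ) := by
    by_contra hcon
    rcases hpq (hclosed.frontier_eq ▸ ⟨hx, hcon⟩ :
      (⟨x, hbΓ hx⟩ : Γ) ∈ frontier (Subtype.val ⁻¹' b : Set Γ)) with h | h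
    · rw [← h, dist_self] at hxp; linarith
    · rw [← (mem_singleton_iff.1 h), dist_self] at hxq; linarith
  refine ⟨x, hx, fun y hy hxy => ?_⟩
  rcases eq_or_ne x y with rfl | hne
  · exact ⟨_, hxint, rfl⟩
  obtain ⟨c, hcΓ, -, hcconn, hxc, hyc, hcd⟩ := hbt x (hbΓ hx) y hy hne
  have hcsmall : diam c < R / 5 := by
    refine hcd.trans_lt ?_
    calc S * dist x y < S * ((5 * S)⁻¹ * R) := by gcongr
      _ = R / 5 := by field_simp
  have hfar : ∀ z ∈ c, dist x z < R / 5 := fun z hz =>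
    (dist_le_diam_of_mem (hΓ.subset hcΓ) hxc hz).trans_lt hcsmall
  have hcpre : IsPreconnected (Subtype.val ⁻¹' c : Set Γ) := by
    rw [IsInducing.subtypeVal.isPreconnected_image.symm, Subtype.image_preimage_coe,
      inter_eq_self_of_subset_right hcΓ]
    exact hcconn.isPreconnected
  have hsub : (Subtype.val ⁻¹' c : Set Γ) ⊆ interior (Subtype.val ⁻¹' b : Set Γ) := by
    refine hcpre.subset_left_of_subset_union isOpen_interior hclosed.isOpen_compl
      (disjoint_compl_right.mono_left interior_subset) (fun z hz => ?_) ⟨⟨x, hbΓ hx⟩, hxc, hxint⟩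
    by_contra hcon
    rw [mem_union, not_or, notMem_compl_iff] at hcon
    have hzd := hfar z hz
    rcases hpq (hclosed.frontier_eq ▸ ⟨hcon.2, hcon.1⟩ :
      z ∈ frontier (Subtype.val ⁻¹' b : Set Γ)) with h | h
    · rw [← h] at hxp; linarith
    · rw [← (mem_singleton_iff.1 h)] at hxq; linarith
  exact ⟨⟨y, hy⟩, hsub hyc, rfl⟩

theorem exists_isometry_hausdorffMeasure_segment {P Q : E2} (hPQ : P ≠ Q) :
    ∃ γ : ℝ → E2, Isometry γ ∧ γ '' Icc 0 (dist P Q) = segment ℝ P Q ∧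
      (μH[1] : Measure E2).restrict (segment ℝ P Q) =
        (volume.restrict (Icc 0 (dist P Q))).map γ := by
  have hl : 0 < dist P Q := dist_pos.2 hPQ
  have hγ : Isometry fun τ : ℝ => P + (τ / dist P Q) • (Q - P) := by
    refine Isometry.of_dist_eq fun τ σ => ?_
    rw [dist_add_left, dist_eq_norm, ← sub_smul, norm_smul, ← dist_eq_norm Q P, dist_comm Q P,
      ← sub_div, norm_div, Real.norm_of_nonneg hl.le, div_mul_cancel₀ _ hl.ne', dist_eq_norm]
  have himg : (fun τ : ℝ => P + (τ / dist P Q) • (Q - P)) '' Icc 0 (dist P Q)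
      = segment ℝ P Q := by
    rw [segment_eq_image']
    ext z
    constructor
    · rintro ⟨τ, hτ, rfl⟩
      exact ⟨τ / dist P Q, ⟨div_nonneg hτ.1 hl.le, (div_le_one hl).2 hτ.2⟩, rfl⟩
    · rintro ⟨τ, hτ, rfl⟩
      refine ⟨τ * dist P Q, ⟨mul_nonneg hτ.1 hl.le, mul_le_of_le_one_left hl.le hτ.2⟩, ?_⟩
      simp only [mul_div_cancel_right₀ _ hl.ne']
  refine ⟨_, hγ, himg, ?_⟩
  have hmeas : MeasurableSet (segment ℝ P Q) := by
    rw [← himg]; exact (isCompact_Icc.image hγ.continuous).measurableSet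
  have hpre : Icc 0 (dist P Q) = (fun τ : ℝ => P + (τ / dist P Q) • (Q - P)) ⁻¹' segment ℝ P Q := by
    rw [← himg, preimage_image_eq _ hγ.injective]
  conv_rhs => rw [hpre]
  rw [← Measure.restrict_map hγ.continuous.measurable hmeas, ← hausdorffMeasure_real,
    hγ.map_hausdorffMeasure (Or.inl zero_le_one), Measure.restrict_restrict hmeas,
    inter_eq_self_of_subset_left]
  rw [← himg]; exact image_subset_range _ _

theorem ofReal_min_le_hausdorffMeasure_segment_ball {P Q ξ : E2} (hPQ : P ≠ Q)
    (hξ : ξ ∈ segment ℝ P Q) (t : ℝ) :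
    ENNReal.ofReal (min t (dist P Q / 2)) ≤
      (μH[1] : Measure E2).restrict (segment ℝ P Q) (ball ξ t) := by
  obtain ⟨γ, hγ, himg, hmap⟩ := exists_isometry_hausdorffMeasure_segment hPQ
  have hl : 0 < dist P Q := dist_pos.2 hPQ
  rw [← himg] at hξ
  obtain ⟨τ, hτ, rfl⟩ := hξ
  rw [hmap, Measure.map_apply hγ.continuous.measurable measurableSet_ball, hγ.preimage_ball,
    Measure.restrict_apply measurableSet_ball]
  set m := min t (dist P Q / 2) with hm
  have hmt : m ≤ t := min_le_left _ _
  have hml : m ≤ dist P Q / 2 := min_le_right _ _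
  rcases le_total τ (dist P Q / 2) with h | h
  · refine le_trans (by simp) (measure_mono (μ := volume) (s := Ioo τ (τ + m)) ?_)
    rintro σ ⟨h1, h2⟩
    refine ⟨?_, by linarith [hτ.1], by linarith⟩
    rw [mem_ball, Real.dist_eq, abs_lt]; constructor <;> linarith
  · refine le_trans (by simp) (measure_mono (μ := volume) (s := Ioo (τ - m) τ) ?_)
    rintro σ ⟨h1, h2⟩
    refine ⟨?_, by linarith [hτ.1], by linarith [hτ.2]⟩
    rw [mem_ball, Real.dist_eq, abs_lt]; constructor <;> linarith

theorem lintegral_rpow_dist_le {ε : ℝ} (hε : 0 < ε) {a : ℝ} (ha : 0 ≤ a) (c : ℝ) :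
    ∫⁻ τ in closedBall c a, ENNReal.ofReal (dist τ c ^ (ε - 1)) ≤
      ENNReal.ofReal (2 * (a ^ ε / ε)) := by
  have hpos : ∫⁻ τ in Icc 0 a, ENNReal.ofReal (|τ| ^ (ε - 1)) = ENNReal.ofReal (a ^ ε / ε) := by
    have hint : IntegrableOn (fun τ : ℝ => τ ^ (ε - 1)) (Ioc 0 a) :=
      (intervalIntegrable_iff_integrableOn_Ioc_of_le ha).1
        (intervalIntegral.intervalIntegrable_rpow' (by linarith))
    have hval := integral_rpow (a := 0) (b := a) (r := ε - 1) (Or.inl (by linarith))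
    rw [intervalIntegral.integral_of_le ha, sub_add_cancel, Real.zero_rpow hε.ne', sub_zero] at hval
    rw [← hval, restrict_Ioc_eq_restrict_Icc.symm, ofReal_integral_eq_lintegral_ofReal hint]
    · refine setLIntegral_congr_fun measurableSet_Ioc fun τ hτ => ?_
      simp only [abs_of_pos hτ.1]
    · filter_upwards [ae_restrict_mem measurableSet_Ioc] with τ hτ
      exact Real.rpow_nonneg hτ.1.le _
  have hneg : ∫⁻ τ in Icc (-a) 0, ENNReal.ofReal (|τ| ^ (ε - 1)) = ENNReal.ofReal (a ^ ε / ε) := by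
    rw [← hpos, ← (Measure.measurePreserving_neg (volume : Measure ℝ)).setLIntegral_comp_preimage_emb
      (MeasurableEquiv.neg ℝ).measurableEmbedding]
    simp
  have hshift : ∫⁻ τ in closedBall c a, ENNReal.ofReal (dist τ c ^ (ε - 1)) =
      ∫⁻ τ in Icc (-a) a, ENNReal.ofReal (|τ| ^ (ε - 1)) := by
    rw [← (measurePreserving_sub_right (volume : Measure ℝ) c).setLIntegral_comp_preimage_emb
      (MeasurableEquiv.subRight c).measurableEmbedding _ (Icc (-a) a)]
    simp [Real.dist_eq, Real.closedBall_eq_Icc, add_comm, sub_eq_add_neg]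
  rw [hshift, ← Icc_union_Icc_eq_Icc (neg_nonpos.2 ha) ha]
  refine (lintegral_union_le _ _ _).trans ?_
  rw [hneg, hpos, ← ENNReal.ofReal_add (by positivity) (by positivity), two_mul]

theorem lintegral_segment_kernel_le {P Q : E2} (hPQ : P ≠ Q) {β ε ρ : ℝ} (hε : 0 < ε) (hε1 : ε ≤ 1)
    (hεβ : ε ≤ β) (hρ : 0 < ρ) (η : E2) :
    ∫⁻ ξ in segment ℝ P Q, (if dist ξ η ≤ ρ then
        ENNReal.ofReal (dist ξ η ^ β * ((dist ξ η)⁻¹ + 2 / dist P Q)) else 0) ∂μH[1] ≤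
      ENNReal.ofReal ((8 / ε + 2) * ρ ^ β) := by
  obtain ⟨γ, hγ, -, hmap⟩ := exists_isometry_hausdorffMeasure_segment hPQ
  have hl : 0 < dist P Q := dist_pos.2 hPQ
  set l := dist P Q
  rw [hmap, lintegral_map (Measurable.ite (measurableSet_le (by fun_prop) (by fun_prop))
    (by fun_prop) (by fun_prop)) hγ.continuous.measurable]
  have hγc := hγ.continuous
  obtain ⟨τ₀, hτ₀, hmin⟩ := isCompact_Icc.exists_isMinOn (nonempty_Icc.2 hl.le)
    (f := fun τ => dist (γ τ) η) (by fun_prop)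
  have hdist : ∀ τ ∈ Icc 0 l, dist τ τ₀ ≤ 2 * dist (γ τ) η := by
    intro τ hτ
    have h1 : dist (γ τ₀) η ≤ dist (γ τ) η := hmin hτ
    have h2 := dist_triangle_right (γ τ) (γ τ₀) η
    rw [hγ.dist_eq] at h2
    linarith
  have hpt : ∀ τ ∈ Icc 0 l, τ ≠ τ₀ → (if dist (γ τ) η ≤ ρ then
      ENNReal.ofReal (dist (γ τ) η ^ β * ((dist (γ τ) η)⁻¹ + 2 / l)) else 0) ≤
      (closedBall τ₀ (2 * ρ)).indicator (fun τ => ENNReal.ofReal (2 * ρ ^ (β - ε)) *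
        ENNReal.ofReal (dist τ τ₀ ^ (ε - 1))) τ + ENNReal.ofReal (ρ ^ β * (2 / l)) := by
    intro τ hτ hne
    split_ifs with ht
    swap; · exact zero_le
    have hσ : 0 < dist τ τ₀ := dist_pos.2 hne
    have hd := hdist τ hτ
    set t := dist (γ τ) η
    have ht0 : 0 < t := by linarith
    rw [indicator_of_mem (by rw [mem_closedBall]; linarith), ← ENNReal.ofReal_mul (by positivity),
      ← ENNReal.ofReal_add (by positivity) (by positivity), mul_add]
    refine ENNReal.ofReal_le_ofReal (add_le_add ?_ ?_)
    · have e1 : t ^ β * t⁻¹ = t ^ (β - ε) * t ^ (ε - 1) := by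
        rw [← Real.rpow_neg_one, ← Real.rpow_add ht0, ← Real.rpow_add ht0]; congr 1; ring
      have e2 : t ^ (ε - 1) ≤ 2 * dist τ τ₀ ^ (ε - 1) := by
        calc t ^ (ε - 1) ≤ (dist τ τ₀ / 2) ^ (ε - 1) :=
              Real.rpow_le_rpow_of_nonpos (by positivity) (by linarith) (by linarith)
          _ = 2 ^ (1 - ε) * dist τ τ₀ ^ (ε - 1) := by
              rw [Real.div_rpow hσ.le zero_le_two, div_eq_inv_mul, ← Real.rpow_neg zero_le_two,
                neg_sub]
          _ ≤ 2 * dist τ τ₀ ^ (ε - 1) := by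
              gcongr
              calc (2 : ℝ) ^ (1 - ε) ≤ 2 ^ (1 : ℝ) :=
                    Real.rpow_le_rpow_of_exponent_le one_le_two (by linarith)
                _ = 2 := Real.rpow_one 2
      have e3 : t ^ (β - ε) ≤ ρ ^ (β - ε) := Real.rpow_le_rpow ht0.le ht (by linarith)
      rw [e1]
      calc t ^ (β - ε) * t ^ (ε - 1) ≤ ρ ^ (β - ε) * (2 * dist τ τ₀ ^ (ε - 1)) := by gcongr
        _ = 2 * ρ ^ (β - ε) * dist τ τ₀ ^ (ε - 1) := by ring
    · gcongr
      linarith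
  have hae : ∀ᵐ τ ∂volume.restrict (Icc 0 l), τ ≠ τ₀ :=
    ae_restrict_of_ae (Measure.ae_ne volume τ₀)
  calc _ ≤ ∫⁻ τ in Icc 0 l, ((closedBall τ₀ (2 * ρ)).indicator
          (fun τ => ENNReal.ofReal (2 * ρ ^ (β - ε)) *
          ENNReal.ofReal (dist τ τ₀ ^ (ε - 1))) τ + ENNReal.ofReal (ρ ^ β * (2 / l))) := by
        refine lintegral_mono_ae ?_
        filter_upwards [hae, ae_restrict_mem measurableSet_Icc] with τ h1 h2 using hpt τ h2 h1
    _ = (∫⁻ τ in Icc 0 l, (closedBall τ₀ (2 * ρ)).indicator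
          (fun τ => ENNReal.ofReal (2 * ρ ^ (β - ε)) *
          ENNReal.ofReal (dist τ τ₀ ^ (ε - 1))) τ) + ENNReal.ofReal (2 * ρ ^ β) := by
        rw [lintegral_add_right _ measurable_const, lintegral_const, Measure.restrict_apply_univ,
          Real.volume_Icc, ← ENNReal.ofReal_mul (by positivity)]
        congr 2
        field_simp
        simp
    _ ≤ ENNReal.ofReal (2 * ρ ^ (β - ε)) * ENNReal.ofReal (2 * ((2 * ρ) ^ ε / ε)) +
          ENNReal.ofReal (2 * ρ ^ β) := by
        gcongr
        refine (setLIntegral_le_lintegral _ _).trans ?_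
        rw [lintegral_indicator measurableSet_closedBall, lintegral_const_mul _ (by fun_prop)]
        gcongr
        exact lintegral_rpow_dist_le hε (by positivity) τ₀
    _ ≤ ENNReal.ofReal ((8 / ε + 2) * ρ ^ β) := by
        rw [← ENNReal.ofReal_mul (by positivity),
          ← ENNReal.ofReal_add (by positivity) (by positivity), add_mul]
        refine ENNReal.ofReal_le_ofReal (add_le_add_left ?_ _)
        have h2 : (2 : ℝ) ^ ε ≤ 2 := by
          simpa using Real.rpow_le_rpow_of_exponent_le one_le_two hε1
        have h3 : ρ ^ (β - ε) * ρ ^ ε = ρ ^ β := by rw [← Real.rpow_add hρ]; congr 1; ring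
        rw [Real.mul_rpow zero_le_two hρ.le]
        calc 2 * ρ ^ (β - ε) * (2 * (2 ^ ε * ρ ^ ε / ε))
            = 4 / ε * 2 ^ ε * (ρ ^ (β - ε) * ρ ^ ε) := by ring
          _ ≤ 4 / ε * 2 * (ρ ^ (β - ε) * ρ ^ ε) := by gcongr
          _ = 8 / ε * ρ ^ β := by rw [h3]; ring

/-- The mass of the segment itself bounds the denominator of the energy density from below. -/
theorem energy_kernel_le {P Q : E2} (hPQ : P ≠ Q) {c : ℝ≥0∞} (hc0 : c ≠ 0) (hctop : c ≠ ⊤)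
    {ν : Measure E2} (hν : c • (μH[1] : Measure E2).restrict (segment ℝ P Q) ≤ ν)
    {u : E2 → ℝ} {K : ℝ≥0} (hu : LipschitzWith K u) (α : ℝ) {ξ : E2} (hξ : ξ ∈ segment ℝ P Q)
    (η : E2) :
    ENNReal.ofReal ((u ξ - u η) ^ 2) /
        (ENNReal.ofReal (dist ξ η ^ (2 * α - 1)) * ν (ball ξ (dist ξ η))) ≤
      c⁻¹ * ENNReal.ofReal ((K : ℝ) ^ 2) * ENNReal.ofReal
        (dist ξ η ^ (3 - 2 * α) * ((dist ξ η)⁻¹ + 2 / dist P Q)) := by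
  rcases eq_or_ne ξ η with rfl | hne
  · simp
  have hl : 0 < dist P Q := dist_pos.2 hPQ
  have ht : 0 < dist ξ η := dist_pos.2 hne
  set t := dist ξ η
  have hm : 0 < min t (dist P Q / 2) := lt_min ht (by positivity)
  have hball : c * ENNReal.ofReal (min t (dist P Q / 2)) ≤ ν (ball ξ t) :=
    (mul_le_mul_right (ofReal_min_le_hausdorffMeasure_segment_ball hPQ hξ t) c).trans (hν _)
  have hnum : (u ξ - u η) ^ 2 ≤ (K : ℝ) ^ 2 * t ^ 2 := by
    rw [← mul_pow, sq_le_sq, abs_of_nonneg (by positivity : 0 ≤ (K : ℝ) * t), ← Real.dist_eq]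
    exact hu.dist_le_mul ξ η
  have hinv : (min t (dist P Q / 2))⁻¹ ≤ t⁻¹ + 2 / dist P Q := by
    have h2 : (dist P Q / 2)⁻¹ = 2 / dist P Q := inv_div _ _
    rcases min_choice t (dist P Q / 2) with h | h <;> rw [h]
    · linarith [div_pos two_pos hl]
    · linarith [inv_pos.2 ht]
  calc _ ≤ ENNReal.ofReal ((K : ℝ) ^ 2 * t ^ 2) / (ENNReal.ofReal (t ^ (2 * α - 1)) *
          (c * ENNReal.ofReal (min t (dist P Q / 2)))) := by gcongr
    _ = c⁻¹ * ENNReal.ofReal ((K : ℝ) ^ 2) *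
          ENNReal.ofReal (t ^ (3 - 2 * α) * (min t (dist P Q / 2))⁻¹) := by
        have e : (K : ℝ) ^ 2 * t ^ 2 = (K : ℝ) ^ 2 * (t ^ (3 - 2 * α) *
            (min t (dist P Q / 2))⁻¹) * (t ^ (2 * α - 1) * min t (dist P Q / 2)) := by
          have : t ^ 2 = t ^ (3 - 2 * α) * t ^ (2 * α - 1) := by
            rw [← Real.rpow_add ht, ← Real.rpow_two]; congr 1; ring
          rw [this]; field_simp
        have hd : 0 < t ^ (2 * α - 1) * min t (dist P Q / 2) := by positivity
        rw [mul_left_comm, ← ENNReal.ofReal_mul (by positivity), e,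
          ENNReal.ofReal_mul (by positivity), ENNReal.ofReal_mul (p := (K : ℝ) ^ 2) (by positivity),
          ENNReal.div_eq_inv_mul, ENNReal.mul_inv (Or.inl hc0) (Or.inl hctop)]
        set D := ENNReal.ofReal (t ^ (2 * α - 1) * min t (dist P Q / 2))
        have hD0 : D ≠ 0 := (ENNReal.ofReal_pos.2 hd).ne'
        rw [mul_comm _ D, ← mul_assoc, mul_assoc c⁻¹ D⁻¹ D,
          ENNReal.inv_mul_cancel hD0 ENNReal.ofReal_ne_top, mul_one, mul_assoc]
    _ ≤ _ := by gcongr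

theorem exists_energy_segment_majorant {P Q : E2} {m : ℝ≥0∞} (hm : m ≠ ⊤)
    {ν : Measure E2} [SFinite ν] (hν : (m / ENNReal.ofReal (dist P Q)) •
      (μH[1] : Measure E2).restrict (segment ℝ P Q) ≤ ν)
    {u : E2 → ℝ} {K : ℝ≥0} (hu : LipschitzWith K u) {α ε ρ : ℝ} (hε : 0 < ε) (hε1 : ε ≤ 1)
    (hεα : ε ≤ 3 - 2 * α) (hρ : 0 < ρ) :
    ∃ H : E2 → ℝ≥0∞, Measurable H ∧
      (∀ η, H η ≤ ENNReal.ofReal ((K : ℝ) ^ 2 * ((8 / ε + 2) * ρ ^ (3 - 2 * α)))) ∧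
      (∀ η, (∀ ξ ∈ segment ℝ P Q, ρ < dist ξ η) → H η = 0) ∧
      (m / ENNReal.ofReal (dist P Q)) * ∫⁻ ξ in segment ℝ P Q, ∫⁻ η,
        (if dist ξ η ≤ ρ then
          ENNReal.ofReal ((u ξ - u η) ^ 2) /
            (ENNReal.ofReal ((dist ξ η) ^ (2 * α - 1)) * ν (ball ξ (dist ξ η)))
        else 0) ∂ν ∂μH[1] ≤ ∫⁻ η, H η ∂ν := by
  rcases eq_or_ne P Q with rfl | hPQ
  · refine ⟨0, measurable_zero, fun _ => zero_le, fun _ _ => rfl, ?_⟩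
    have : (μH[1] : Measure E2).restrict {P} = 0 := by
      have := Measure.nullSingletonClass_hausdorff E2 one_pos
      simp
    rw [segment_same, this]; simp
  set c := m / ENNReal.ofReal (dist P Q)
  have hctop : c ≠ ⊤ := ENNReal.div_ne_top hm (ENNReal.ofReal_pos.2 (dist_pos.2 hPQ)).ne'
  by_cases hc0 : c = 0
  · exact ⟨0, measurable_zero, fun _ => zero_le, fun _ _ => rfl, by simp [hc0]⟩
  obtain ⟨γ, hγ, himg, hmap⟩ := exists_isometry_hausdorffMeasure_segment hPQ
  have hsf : SFinite ((μH[1] : Measure E2).restrict (segment ℝ P Q)) := by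
    rw [hmap]; infer_instance
  have hseg : MeasurableSet (segment ℝ P Q) := by
    rw [← himg]; exact (isCompact_Icc.image hγ.continuous).measurableSet
  let g : E2 → E2 → ℝ≥0∞ := fun ξ η => if dist ξ η ≤ ρ then
    ENNReal.ofReal (dist ξ η ^ (3 - 2 * α) * ((dist ξ η)⁻¹ + 2 / dist P Q)) else 0
  have hg : Measurable (Function.uncurry g) :=
    Measurable.ite (measurableSet_le (by fun_prop) (by fun_prop)) (by fun_prop) (by fun_prop)
  have hright : Measurable fun ξ => ∫⁻ η, g ξ η ∂ν := hg.lintegral_prod_right'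
  have hleft : Measurable fun η => ∫⁻ ξ in segment ℝ P Q, g ξ η ∂μH[1] := hg.lintegral_prod_left'
  let κ := ENNReal.ofReal ((K : ℝ) ^ 2)
  refine ⟨fun η => κ * ∫⁻ ξ in segment ℝ P Q, g ξ η ∂μH[1],
    hleft.const_mul _, fun η => ?_, fun η hη => ?_, ?_⟩
  · rw [ENNReal.ofReal_mul (by positivity)]
    exact mul_le_mul_right (lintegral_segment_kernel_le hPQ hε hε1 hεα hρ η) _
  · have : ∫⁻ ξ in segment ℝ P Q, g ξ η ∂μH[1] = 0 := by
      rw [setLIntegral_congr_fun hseg (f := fun ξ => g ξ η) (g := fun _ => 0)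
        fun ξ hξ => if_neg (hη ξ hξ).not_ge]
      simp
    simp [this]
  · calc _ ≤ c * ∫⁻ ξ in segment ℝ P Q, ∫⁻ η, (c⁻¹ * κ) * g ξ η ∂ν ∂μH[1] := by
          refine mul_le_mul_right (setLIntegral_mono' hseg fun ξ hξ => lintegral_mono fun η => ?_) _
          simp only [g]
          split_ifs
          · exact energy_kernel_le hPQ hc0 hctop hν hu α hξ η
          · simp
      _ = κ * ∫⁻ ξ in segment ℝ P Q, ∫⁻ η, g ξ η ∂ν ∂μH[1] := by
          have h1 : ∀ ξ, ∫⁻ η, (c⁻¹ * κ) * g ξ η ∂ν = (c⁻¹ * κ) * ∫⁻ η, g ξ η ∂ν := fun ξ =>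
            lintegral_const_mul _ hg.of_uncurry_left
          simp_rw [h1]
          rw [lintegral_const_mul _ hright, ← mul_assoc, ← mul_assoc,
            ENNReal.mul_inv_cancel hc0 hctop, one_mul]
      _ = ∫⁻ η, κ * ∫⁻ ξ in segment ℝ P Q, g ξ η ∂μH[1] ∂ν := by
          rw [lintegral_lintegral_swap hg.aemeasurable, lintegral_const_mul _ hleft]

theorem sum_measure_le_of_card_le {ι X : Type*} [Fintype ι] [MeasurableSpace X] (μ : Measure X)
    [IsProbabilityMeasure μ] {a : ι → Set X} (ha : ∀ i, MeasurableSet (a i)) {N : ℕ}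
    (hN : ∀ y, ∀ s : Finset ι, (∀ i ∈ s, y ∈ a i) → s.card ≤ N) : ∑ i, μ (a i) ≤ N := by
  classical
  calc ∑ i, μ (a i) = ∑ i, ∫⁻ y, (a i).indicator 1 y ∂μ := by
        simp_rw [lintegral_indicator_one (ha _)]
    _ = ∫⁻ y, ∑ i, (a i).indicator 1 y ∂μ :=
        (lintegral_finsetSum _ fun i _ => measurable_one.indicator (ha i)).symm
    _ ≤ ∫⁻ _, N ∂μ := by
        refine lintegral_mono fun y => ?_
        simp only [indicator_apply, Pi.one_apply, Finset.sum_boole]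
        exact_mod_cast hN y _ (by simp)
    _ = N := by simp

/-- Quantitative bound of the short-range energy of a polygonal measure with bounded overlap `N`. -/
theorem short_range_energy_le {ι : Type*} [Fintype ι] {μ : Measure E2} [IsProbabilityMeasure μ]
    {a : ι → Set E2} {pe qe x : ι → E2} {N : ℕ} {R M A : ℝ} (hMR : 0 ≤ M * R)
    (ha : ∀ i, IsCompact (a i)) (hdiam : ∀ i, diam (a i) ≤ M * R)
    (hpe : ∀ i, pe i ∈ a i) (hqe : ∀ i, qe i ∈ a i) (hx : ∀ i, x i ∈ a i)
    (hN : ∀ y, ∀ s : Finset ι, (∀ i ∈ s, dist (x i) y ≤ (A + 2 * M) * R) → s.card ≤ N)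
    {ν : Measure E2} (hν : ν = ∑ i, (μ (a i) / ENNReal.ofReal (dist (pe i) (qe i))) •
        ((μH[1] : Measure E2).restrict (segment ℝ (pe i) (qe i))))
    {u : E2 → ℝ} {K : ℝ≥0} (hu : LipschitzWith K u) {α ε ρ : ℝ} (hε : 0 < ε) (hε1 : ε ≤ 1)
    (hεα : ε ≤ 3 - 2 * α) (hρ : 0 < ρ) (hρR : ρ ≤ A * R) :
    ∫⁻ ξ, ∫⁻ η, (if dist ξ η ≤ ρ then
          ENNReal.ofReal ((u ξ - u η) ^ 2) /
            (ENNReal.ofReal ((dist ξ η) ^ (2 * α - 1)) * ν (ball ξ (dist ξ η)))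
        else 0) ∂ν ∂ν ≤
      N * ENNReal.ofReal ((K : ℝ) ^ 2 * ((8 / ε + 2) * ρ ^ (3 - 2 * α))) * N := by
  classical
  have hclose : ∀ i, ∀ y ∈ a i, ∀ z ∈ a i, dist y z ≤ M * R := fun i y hy z hz =>
    (dist_le_diam_of_mem (ha i).isBounded hy hz).trans (hdiam i)
  have hmass : ν univ ≤ N := by
    refine le_trans ?_ (sum_measure_le_of_card_le μ (fun i => (ha i).measurableSet)
      fun y s hs => hN y s fun i hi => ?_)
    · rw [hν, Measure.finsetSum_apply]
      refine Finset.sum_le_sum fun i _ => ?_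
      rw [Measure.smul_apply, Measure.restrict_apply_univ, hausdorffMeasure_segment, edist_dist,
        smul_eq_mul, mul_comm]
      exact ENNReal.mul_div_le
    · have := hclose i _ (hx i) y (hs i hi)
      linarith
  have hfin : IsFiniteMeasure ν := ⟨hmass.trans_lt (ENNReal.natCast_lt_top N)⟩
  have hle : ∀ i, (μ (a i) / ENNReal.ofReal (dist (pe i) (qe i))) •
      ((μH[1] : Measure E2).restrict (segment ℝ (pe i) (qe i))) ≤ ν := by
    intro i
    rw [hν, Measure.le_iff']
    intro s
    rw [Measure.finsetSum_apply]
    exact Finset.single_le_sum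
      (f := fun i => ((μ (a i) / ENNReal.ofReal (dist (pe i) (qe i))) •
      ((μH[1] : Measure E2).restrict (segment ℝ (pe i) (qe i)))) s)
      (fun _ _ => zero_le) (Finset.mem_univ i)
  choose H hHm hHle hH0 hH using fun i =>
    exists_energy_segment_majorant (measure_ne_top μ (a i)) (hle i) hu hε hε1 hεα hρ
  set B := ENNReal.ofReal ((K : ℝ) ^ 2 * ((8 / ε + 2) * ρ ^ (3 - 2 * α)))
  have hsum : ∀ η, ∑ i, H i η ≤ N * B := by
    intro η
    rw [← Finset.sum_filter_ne_zero]
    refine (Finset.sum_le_card_nsmul _ _ B fun i _ => hHle i η).trans ?_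
    rw [nsmul_eq_mul]
    gcongr
    refine hN η _ fun i hi => ?_
    obtain ⟨ξ, hξ, hξη⟩ : ∃ ξ ∈ segment ℝ (pe i) (qe i), dist ξ η ≤ ρ := by
      by_contra! h
      exact (Finset.mem_filter.1 hi).2 (hH0 i η h)
    have h1 : dist (pe i) ξ ≤ M * R :=
      (dist_add_dist_of_mem_segment hξ ▸ le_add_of_nonneg_right dist_nonneg :
        dist (pe i) ξ ≤ dist (pe i) (qe i)).trans (hclose i _ (hpe i) _ (hqe i))
    have h2 := hclose i _ (hx i) _ (hpe i)
    have h3 := dist_triangle4 (x i) (pe i) ξ η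
    linarith
  have hint : ∀ f : E2 → ℝ≥0∞, ∫⁻ ξ, f ξ ∂ν =
      ∑ i, (μ (a i) / ENNReal.ofReal (dist (pe i) (qe i))) *
        ∫⁻ ξ in segment ℝ (pe i) (qe i), f ξ ∂μH[1] := by
    intro f
    simp_rw [hν, lintegral_finsetSum_measure, lintegral_smul_measure, smul_eq_mul]
  calc _ = ∑ i, (μ (a i) / ENNReal.ofReal (dist (pe i) (qe i))) *
        ∫⁻ ξ in segment ℝ (pe i) (qe i), ∫⁻ η, (if dist ξ η ≤ ρ then
          ENNReal.ofReal ((u ξ - u η) ^ 2) /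
            (ENNReal.ofReal ((dist ξ η) ^ (2 * α - 1)) * ν (ball ξ (dist ξ η)))
        else 0) ∂ν ∂μH[1] := hint _
    _ ≤ ∑ i, ∫⁻ η, H i η ∂ν := Finset.sum_le_sum fun i _ => hH i
    _ = ∫⁻ η, ∑ i, H i η ∂ν := (lintegral_finsetSum _ fun i _ => hHm i).symm
    _ ≤ ∫⁻ _, N * B ∂ν := lintegral_mono hsum
    _ ≤ N * B * N := by rw [lintegral_const]; gcongr

theorem stmt_10
    (Γ : Set E2) (hΓcomp : IsCompact Γ)
    (hΓJ : Nonempty (↥Γ ≃ₜ ↥(sphere (0:E2) 1)))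
    (S : ℝ) (hS1 : 1 ≤ S)
    (hbt : ∀ x ∈ Γ, ∀ y ∈ Γ, x ≠ y → ∃ b : Set E2, b ⊆ Γ ∧ IsClosed b ∧ IsConnected b ∧
      x ∈ b ∧ y ∈ b ∧ diam b ≤ S * dist x y)
    (p q M : ℝ) (hp0 : 0 < p) (hp1 : p < 1) (hq0 : 0 < q) (hq1 : q < 1) (hM : 1 < M)
    (ω : ℕ → ℝ) (hω : ∀ i, ω i = p ∨ ω i = q)
    (k : ℕ → ℕ) (hk : ∀ n, 0 < k n)
    (a : (n : ℕ) → Fin (k n) → Set E2)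
    (pe qe : (n : ℕ) → Fin (k n) → E2)
    (harc : ∀ n j, a n j ⊆ Γ ∧ IsClosed (a n j) ∧ IsConnected (a n j) ∧
      pe n j ∈ a n j ∧ qe n j ∈ a n j)
    (hcover : ∀ n, (⋃ j, a n j) = Γ)
    (hdisj : ∀ n, Pairwise fun j j' => Disjoint (relInt Γ (a n j)) (relInt Γ (a n j')))
    (hdiam : ∀ n j, (∏ i ∈ Finset.range n, ω i) * diam Γ ≤ diam (a n j) ∧
      diam (a n j) < M * ((∏ i ∈ Finset.range n, ω i) * diam Γ))
    (d s cμ : ℝ) (hd1 : 1 ≤ d) (hds : d ≤ s) (hs2 : s < 2) (hcμ : 1 < cμ)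
    (μ : Measure E2) [IsProbabilityMeasure μ]
    (hsupp : (∀ x ∈ Γ, ∀ r > 0, 0 < μ (ball x r)) ∧ μ Γᶜ = 0)
    (hdbl : ∀ x ∈ Γ, ∀ r > 0, ∀ t > 1, t * r ≤ diam Γ →
      cμ⁻¹ * t ^ d * (μ (ball x r)).toReal ≤ (μ (ball x (t * r))).toReal ∧
      (μ (ball x (t * r))).toReal ≤ cμ * t ^ s * (μ (ball x r)).toReal)
    (hB : ∀ x ∈ Γ, ∀ r : ℝ, 0 < r → r < diam Γ → μ (sphere x r) = 0)
    (μn : ℕ → Measure E2)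
    (hμn : ∀ n, μn n = ∑ j : Fin (k n),
      (μ (a n j) / ENNReal.ofReal (dist (pe n j) (qe n j))) •
        ((μH[1] : Measure E2).restrict (segment ℝ (pe n j) (qe n j))))
    (rn : ℕ → ℝ)
    (hrnd : ∀ n, rn n = (∏ i ∈ Finset.range n, ω i) * diam Γ / (2 * M * S))
    (α : ℝ) (hα1 : 1/2 < α) (hα2 : α < 1 + (2 - s)/2)
    (A : ℝ) (hA : max (128 * S) M ≤ A)
    (u : E2 → ℝ) (K : ℝ≥0) (hu : LipschitzWith K u) (Cu : ℝ) (hub : ∀ z, |u z| ≤ Cu) :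
    Tendsto (fun n => ∫⁻ ξ, ∫⁻ η,
        (if dist ξ η ≤ A * rn n then
          ENNReal.ofReal ((u ξ - u η) ^ 2) /
            (ENNReal.ofReal ((dist ξ η) ^ (2*α - 1)) * μn n (ball ξ (dist ξ η)))
        else 0) ∂(μn n) ∂(μn n)) atTop (𝓝 0) := by
  obtain ⟨φ⟩ := hΓJ
  have hΓb : Bornology.IsBounded Γ := hΓcomp.isBounded
  have hΓd : 0 < diam Γ := by
    obtain ⟨v, hv⟩ := (NormedSpace.sphere_nonempty (x := (0 : E2)) (r := 1)).2 zero_le_one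
    have hne : (⟨v, hv⟩ : sphere (0 : E2) 1) ≠ -⟨v, hv⟩ := ne_neg_of_mem_unit_sphere ℝ _
    have hne' := φ.symm.injective.ne hne
    exact (dist_pos.2 fun h => hne' (Subtype.ext h)).trans_le
      (dist_le_diam_of_mem hΓb (φ.symm ⟨v, hv⟩).2 (φ.symm (-⟨v, hv⟩)).2)
  have hωpos : ∀ i, 0 < ω i := fun i => by rcases hω i with h | h <;> rw [h] <;> assumption
  have hA0 : 0 < A := by linarith [le_max_left (128 * S) M]
  set R : ℕ → ℝ := fun n => (∏ i ∈ Finset.range n, ω i) * diam Γ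
  have hR : ∀ n, 0 < R n := fun n => mul_pos (Finset.prod_pos fun i _ => hωpos i) hΓd
  have hR0 : Tendsto R atTop (𝓝 0) := by
    have hmax : ∀ i, ω i ≤ max p q := fun i => by rcases hω i with h | h <;> simp [h]
    refine squeeze_zero (fun n => (hR n).le) (g := fun n => max p q ^ n * diam Γ) (fun n => ?_) ?_
    · refine mul_le_mul_of_nonneg_right ?_ hΓd.le
      simpa using Finset.prod_le_prod (s := Finset.range n) (fun i _ => (hωpos i).le)
        fun i _ => hmax i
    · simpa using (tendsto_pow_atTop_nhds_zero_of_lt_one (hp0.le.trans (le_max_left p q))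
        (max_lt hp1 hq1)).mul_const (diam Γ)
  have hrn : ∀ n, rn n = R n / (2 * M * S) := hrnd
  have hMS : 1 ≤ 2 * M * S := by nlinarith
  have hρpos : ∀ n, 0 < A * rn n := fun n => by
    rw [hrn]; exact mul_pos hA0 (div_pos (hR n) (by linarith))
  have hρle : ∀ n, A * rn n ≤ A * R n := fun n => by
    rw [hrn]; exact mul_le_mul_of_nonneg_left (div_le_self (hR n).le hMS) hA0.le
  have hcomp : ∀ n j, IsCompact (a n j) := fun n j =>
    hΓcomp.of_isClosed_subset (harc n j).2.1 (harc n j).1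
  obtain ⟨N, hN⟩ := exists_card_le_of_separated (A + 2 * M)
    (δ := (5 * S)⁻¹) (inv_pos.2 (by linarith))
  have hx : ∀ n j, ∃ x ∈ a n j, ∀ y ∈ Γ, dist x y < (5 * S)⁻¹ * R n → y ∈ relInt Γ (a n j) :=
    fun n j => exists_relInt_ball φ (harc n j).1 (harc n j).2.1 (harc n j).2.2.1 hS1 hbt hΓb (hR n)
      (hdiam n j).1
  choose x hxa hxball using hx
  have hsep : ∀ n i j, i ≠ j → (5 * S)⁻¹ * R n ≤ dist (x n i) (x n j) := by
    intro n i j hij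
    by_contra! h
    have hj : x n j ∈ relInt Γ (a n j) := hxball n j _ ((harc n j).1 (hxa n j)) (by
      rw [dist_self]; exact mul_pos (inv_pos.2 (by linarith)) (hR n))
    exact disjoint_left.1 (hdisj n hij) (hxball n i _ ((harc n j).1 (hxa n j)) h) hj
  have hβ : 0 < 3 - 2 * α := by linarith
  set ε := min (3 - 2 * α) 1
  have hbound := fun n => short_range_energy_le (μ := μ) (R := R n) (M := M) (A := A)
    (mul_nonneg (by linarith) (hR n).le) (hcomp n)
    (fun j => (hdiam n j).2.le) (fun j => (harc n j).2.2.2.1) (fun j => (harc n j).2.2.2.2) (hxa n)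
    (fun y s hs => hN _ (x n) s y (R n) (hR n) hs fun i _ j _ hij => hsep n i j hij)
    (hμn n) hu (α := α) (ε := ε) (lt_min hβ one_pos) (min_le_right _ _) (min_le_left _ _) (hρpos n)
    (hρle n)
  refine tendsto_of_tendsto_of_tendsto_of_le_of_le tendsto_const_nhds ?_ (fun _ => zero_le) hbound
  have hρ0 : Tendsto (fun n => A * rn n) atTop (𝓝 0) :=
    squeeze_zero (fun n => (hρpos n).le) hρle (by simpa using hR0.const_mul A)
  have hreal : Tendsto (fun n => (K : ℝ) ^ 2 * ((8 / ε + 2) * (A * rn n) ^ (3 - 2 * α))) atTop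
      (𝓝 0) := by
    simpa [Real.zero_rpow hβ.ne'] using
      ((hρ0.rpow_const (Or.inr hβ.le)).const_mul (8 / ε + 2)).const_mul ((K : ℝ) ^ 2)
  have henn := ENNReal.tendsto_ofReal hreal
  rw [ENNReal.ofReal_zero] at henn
  have := ENNReal.Tendsto.mul_const (ENNReal.Tendsto.const_mul henn
    (Or.inr (ENNReal.natCast_ne_top N))) (Or.inr (ENNReal.natCast_ne_top N))
  simpa using this
end
end
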